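/- arXiv:2303.11740 — 4 statements merged into one kernel-verified Lean document; each statement's English description precedes it below -/
import Mathlib

section
/- Let (K, v) be a field of characteristic 0 that is complete with respect to a rank-one discrete valuation v, let K̄ be an algebraic closure of K and denote again by v the unique extension of v to K̄. Then for every a ∈ K̄ \ K the set {v(a − c) : c ∈ K̄, [K(c):K] < [K(a):K]} admits a maximum; in particular δ_K(a) := sup of this set is attained at some c ∈ K̄ with [K(c):K] < [K(a):K]. -/
open Polynomial Filter

noncomputable section

/-- An additive `ℚ`-valued valuation on a field `K` (written additively, with `v 0 = ⊤`). -/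
structure AddVal (K : Type) [Field K] where
  v : K → WithTop ℚ
  v_eq_top_iff : ∀ x : K, v x = ⊤ ↔ x = 0
  v_mul : ∀ x y : K, v (x * y) = v x + v y
  min_le_v_add : ∀ x y : K, min (v x) (v y) ≤ v (x + y)

namespace AddVal

variable {K : Type} [Field K] (w : AddVal K)

/-- A Cauchy sequence with respect to an additive valuation. -/
def IsCauchySeq (s : ℕ → K) : Prop :=
  ∀ γ : ℚ, ∃ N : ℕ, ∀ m ≥ N, ∀ n ≥ N, (γ : WithTop ℚ) < w.v (s m - s n)

/-- Convergence of a sequence to a limit, with respect to an additive valuation. -/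
def TendsToVal (s : ℕ → K) (l : K) : Prop :=
  ∀ γ : ℚ, ∃ N : ℕ, ∀ n ≥ N, (γ : WithTop ℚ) < w.v (s n - l)

/-- A pseudo-convergent sequence: `v (s n - s m) < v (s m - s k)` for `n < m < k`. -/
def IsPseudoConvergent (s : ℕ → K) : Prop :=
  ∀ ⦃n m k : ℕ⦄, n < m → m < k → w.v (s n - s m) < w.v (s m - s k)

/-- A sequence is of transcendental type over a subring (mapped in via `g`) if for every
polynomial `f` over that ring the sequence `v (f (s n))` is eventually constant. -/
def IsTranscendentalTypeOver {R : Type} [CommRing R] (g : R →+* K) (s : ℕ → K) : Prop :=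
  ∀ f : Polynomial R, ∃ N : ℕ, ∀ m ≥ N, ∀ n ≥ N,
    w.v (f.eval₂ g (s m)) = w.v (f.eval₂ g (s n))

/-- A sequence of transcendental type: for every polynomial `f ∈ K[X]`, `v (f (s n))` is
eventually constant. -/
def IsTranscendentalType (s : ℕ → K) : Prop :=
  w.IsTranscendentalTypeOver (RingHom.id K) s

/-- `α` is a pseudo-limit of `s` when `v (s n - α)` is strictly increasing. -/
def IsPseudoLimit (s : ℕ → K) (α : K) : Prop :=
  StrictMono fun n => w.v (s n - α)

/-- The breadth ideal of a pseudo-convergent sequence. -/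
def breadth (s : ℕ → K) : Set K :=
  {x : K | ∀ n : ℕ, w.v (s (n + 1) - s n) < w.v x}

/-- Equivalence of pseudo-convergent sequences. -/
def SeqEquiv (s t : ℕ → K) : Prop :=
  w.breadth s = w.breadth t ∧
    ∀ k : ℕ, ∃ i₀ j₀ : ℕ, ∀ i ≥ i₀, ∀ j ≥ j₀, w.v (s (k + 1) - s k) < w.v (s i - t j)

end AddVal

/-- `α` is transcendental over the image of `g`. -/
def IsTranscOver {R K : Type} [CommRing R] [Field K] (g : R →+* K) (α : K) : Prop :=
  ∀ f : Polynomial R, f ≠ 0 → f.eval₂ g α ≠ 0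

section Krasner

variable {K L : Type*} [NontriviallyNormedField K] [CompleteSpace K] [IsUltrametricDist K]
  [NormedField L] [NormedAlgebra K L] [Algebra.IsAlgebraic K L]

/-- An element of degree smaller than `a` is no closer to `a` than some other conjugate of `a`. -/
theorem exists_isConjRoot_norm_sub_le [CharZero K] [IsAlgClosed L] {a c : L}
    (h : Module.finrank K (IntermediateField.adjoin K {c}) <
      Module.finrank K (IntermediateField.adjoin K {a})) :
    ∃ a' : L, IsConjRoot K a a' ∧ a ≠ a' ∧ ‖a - a'‖ ≤ ‖a - c‖ := by
  by_contra! hlt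
  have hc : IsIntegral K c := Algebra.IsIntegral.isIntegral c
  have ha : IsIntegral K a := Algebra.IsIntegral.isIntegral a
  have hmem : a ∈ IntermediateField.adjoin K {c} :=
    IsKrasner.krasner (minpoly.irreducible ha).separable (IsAlgClosed.splits _) hc hlt
  have := IntermediateField.adjoin.finiteDimensional hc
  exact h.not_ge <| IntermediateField.finrank_le_of_le_right <|
    IntermediateField.adjoin_simple_le_iff.mpr hmem

theorem norm_pow_natDegree_minpoly (x : L) :
    ‖x‖ ^ (minpoly K x).natDegree = ‖(minpoly K x).coeff 0‖ := by
  have hd : (minpoly K x).natDegree ≠ 0 :=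
    (minpoly.natDegree_pos (Algebra.IsIntegral.isIntegral x)).ne'
  rw [NormedAlgebra.norm_eq_spectralNorm K, spectralNorm.spectralNorm_eq_norm_coeff_zero_rpow,
    one_div, Real.rpow_inv_natCast_pow (norm_nonneg _) hd]

end Krasner

theorem natDegree_minpoly_sub_le {K L : Type*} [Field K] [Field L] [Algebra K L]
    [Algebra.IsAlgebraic K L] (a c : L) :
    (minpoly K (a - c)).natDegree ≤ Module.finrank K (IntermediateField.adjoin K {a}) *
      Module.finrank K (IntermediateField.adjoin K {c}) := by
  have hint (x : L) : IsIntegral K x := Algebra.IsIntegral.isIntegral x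
  have := IntermediateField.adjoin.finiteDimensional (hint a)
  have := IntermediateField.adjoin.finiteDimensional (hint c)
  rw [← IntermediateField.adjoin.finrank (hint _)]
  refine le_trans (IntermediateField.finrank_le_of_le_right ?_)
    (IntermediateField.finrank_sup_le _ _)
  rw [IntermediateField.adjoin_simple_le_iff]
  exact sub_mem (le_sup_left (a := IntermediateField.adjoin K {a})
      (IntermediateField.mem_adjoin_simple_self K a))
    (le_sup_right (a := IntermediateField.adjoin K {a})
      (IntermediateField.mem_adjoin_simple_self K c))

/-- The order-reversing map `γ ↦ 2 ^ (-γ)`, with `⊤ ↦ 0`. -/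
def twoPowNeg : WithTop ℚ → ℝ
  | ⊤ => 0
  | (q : ℚ) => 2 ^ (-(q : ℝ))

namespace twoPowNeg

@[simp] theorem map_top : twoPowNeg ⊤ = 0 := rfl

@[simp] theorem map_coe (q : ℚ) : twoPowNeg q = 2 ^ (-(q : ℝ)) := rfl

theorem map_add (x y : WithTop ℚ) : twoPowNeg (x + y) = twoPowNeg x * twoPowNeg y := by
  induction x with
  | top => simp
  | coe x =>
    induction y with
    | top => simp
    | coe y =>
      rw [← WithTop.coe_add]
      simp only [map_coe]
      rw [← Real.rpow_add two_pos]
      push_cast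
      ring_nf

theorem nonneg (x : WithTop ℚ) : 0 ≤ twoPowNeg x := by
  induction x with
  | top => simp
  | coe x => simp only [map_coe]; positivity

theorem strictAnti : StrictAnti twoPowNeg := by
  intro x y hxy
  induction x with
  | top => simp at hxy
  | coe x =>
    induction y with
    | top => simp only [map_coe, map_top]; positivity
    | coe y =>
      have : x < y := by exact_mod_cast hxy
      simpa using Real.rpow_lt_rpow_of_exponent_lt one_lt_two (neg_lt_neg (Rat.cast_lt.mpr this))

theorem exists_le_of_pos {ε : ℝ} (hε : 0 < ε) : ∃ γ : ℚ, twoPowNeg γ ≤ ε := by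
  obtain ⟨n, hn⟩ := exists_pow_lt_of_lt_one hε (by norm_num : (1 / 2 : ℝ) < 1)
  refine ⟨n, hn.le.trans' ?_⟩
  have : twoPowNeg ((n : ℚ) : WithTop ℚ) = (1 / 2) ^ n := by
    rw [twoPowNeg.map_coe]
    simp [Real.rpow_neg]
  exact this.le

end twoPowNeg

namespace AddVal

variable {K : Type} [Field K] (v : AddVal K)

theorem v_zero : v.v 0 = ⊤ := (v.v_eq_top_iff 0).mpr rfl

theorem exists_coe {x : K} (hx : x ≠ 0) : ∃ q : ℚ, v.v x = q :=
  (WithTop.ne_top_iff_exists.mp (mt (v.v_eq_top_iff x).mp hx)).imp fun _ => Eq.symm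

/-- The multiplicative absolute value `x ↦ 2 ^ (-v x)` attached to an additive valuation. -/
def absVal : AbsoluteValue K ℝ where
  toFun x := twoPowNeg (v.v x)
  map_mul' x y := by rw [v.v_mul, twoPowNeg.map_add]
  nonneg' x := twoPowNeg.nonneg _
  eq_zero' x := by
    rw [← twoPowNeg.map_top, twoPowNeg.strictAnti.injective.eq_iff, v.v_eq_top_iff]
  add_le' x y :=
    (twoPowNeg.strictAnti.antitone (v.min_le_v_add x y)).trans <| by
      rw [twoPowNeg.strictAnti.antitone.map_min]
      exact max_le_add_of_nonneg (twoPowNeg.nonneg _) (twoPowNeg.nonneg _)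

theorem absVal_apply (x : K) : v.absVal x = twoPowNeg (v.v x) := rfl

theorem absVal_le_iff {x y : K} : v.absVal x ≤ v.absVal y ↔ v.v y ≤ v.v x :=
  twoPowNeg.strictAnti.le_iff_ge

theorem absVal_add_le_max (x y : K) : v.absVal (x + y) ≤ max (v.absVal x) (v.absVal y) :=
  (twoPowNeg.strictAnti.antitone (v.min_le_v_add x y)).trans_eq
    twoPowNeg.strictAnti.antitone.map_min

/-- A field with a valuation taking the value `1`, as a nontrivially normed field. -/
abbrev nontriviallyNormedField (h : ∃ π : K, v.v π = ((1 : ℚ) : WithTop ℚ)) :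
    NontriviallyNormedField K :=
  letI := v.absVal.toNormedField
  .ofNormNeOne <| h.imp fun π hπ => by
    have hne : π ≠ 0 := fun h0 => by simp [h0, v.v_zero] at hπ
    refine ⟨hne, ?_⟩
    change v.absVal π ≠ 1
    rw [absVal_apply, hπ, twoPowNeg.map_coe]
    norm_num [Real.rpow_neg_one]

theorem completeSpace (h : ∃ π : K, v.v π = ((1 : ℚ) : WithTop ℚ))
    (hcomplete : ∀ s : ℕ → K, v.IsCauchySeq s → ∃ l : K, v.TendsToVal s l) :
    letI := v.nontriviallyNormedField h
    CompleteSpace K := by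
  let := v.nontriviallyNormedField h
  have hnorm (x : K) : ‖x‖ = twoPowNeg (v.v x) := rfl
  refine Metric.complete_of_cauchySeq_tendsto fun s hs => ?_
  obtain ⟨l, hl⟩ := hcomplete s fun γ => by
    obtain ⟨N, hN⟩ := Metric.cauchySeq_iff.mp hs (twoPowNeg γ) (by
      rw [twoPowNeg.map_coe]; positivity)
    refine ⟨N, fun m hm n hn => ?_⟩
    have := hN m hm n hn
    rwa [dist_eq_norm, hnorm, twoPowNeg.strictAnti.lt_iff_gt] at this
  refine ⟨l, Metric.tendsto_atTop.mpr fun ε hε => ?_⟩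
  obtain ⟨γ, hγ⟩ := twoPowNeg.exists_le_of_pos hε
  obtain ⟨N, hN⟩ := hl γ
  refine ⟨N, fun n hn => ?_⟩
  rw [dist_eq_norm, hnorm]
  exact (twoPowNeg.strictAnti (hN n hn)).trans_le hγ

theorem isUltrametricDist (h : ∃ π : K, v.v π = ((1 : ℚ) : WithTop ℚ)) :
    letI := v.nontriviallyNormedField h
    IsUltrametricDist K :=
  letI := v.nontriviallyNormedField h
  IsUltrametricDist.isUltrametricDist_of_forall_norm_add_le_max_norm v.absVal_add_le_max

theorem v_pow (x : K) (n : ℕ) : v.v (x ^ n) = n • v.v x := by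
  induction n with
  | zero =>
    rw [pow_zero, zero_nsmul]
    obtain ⟨q, hq⟩ := v.exists_coe (one_ne_zero : (1 : K) ≠ 0)
    have h := v.v_mul 1 1
    rw [mul_one, hq, ← WithTop.coe_add, WithTop.coe_inj] at h
    rw [hq, ← WithTop.coe_zero, WithTop.coe_inj]
    linarith
  | succ n ih => rw [pow_succ, v.v_mul, ih, succ_nsmul]

section Extension

variable {L : Type} [Field L] [Algebra K L] [Algebra.IsAlgebraic K L]

/-- The normed algebra structure given by an extension of a valuation. -/
abbrev normedAlgebra (h : ∃ π : K, v.v π = ((1 : ℚ) : WithTop ℚ)) (w : AddVal L)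
    (hext : ∀ x : K, w.v (algebraMap K L x) = v.v x) :
    letI := v.nontriviallyNormedField h
    letI := w.absVal.toNormedField
    NormedAlgebra K L :=
  letI := v.nontriviallyNormedField h
  letI := w.absVal.toNormedField
  { (inferInstance : Algebra K L) with
    norm_smul_le := fun r x => by
      rw [Algebra.smul_def, norm_mul]
      refine le_of_eq (congrArg (· * ‖x‖) ?_)
      exact congrArg twoPowNeg (hext r) }

theorem natDegree_nsmul_v
    (h : ∃ π : K, v.v π = ((1 : ℚ) : WithTop ℚ))
    (hcomplete : ∀ s : ℕ → K, v.IsCauchySeq s → ∃ l : K, v.TendsToVal s l)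
    (w : AddVal L) (hext : ∀ x : K, w.v (algebraMap K L x) = v.v x)
    (x : L) :
    (minpoly K x).natDegree • w.v x = v.v ((minpoly K x).coeff 0) := by
  let := v.nontriviallyNormedField h
  let := w.absVal.toNormedField
  let := v.normedAlgebra h w hext
  have := v.completeSpace h hcomplete
  have := v.isUltrametricDist h
  have := norm_pow_natDegree_minpoly (K := K) x
  rw [← norm_pow] at this
  rw [← v_pow]
  exact twoPowNeg.strictAnti.injective this

theorem exists_isConjRoot_v_sub_le [CharZero K] [IsAlgClosed L]
    (h : ∃ π : K, v.v π = ((1 : ℚ) : WithTop ℚ))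
    (hcomplete : ∀ s : ℕ → K, v.IsCauchySeq s → ∃ l : K, v.TendsToVal s l)
    (w : AddVal L) (hext : ∀ x : K, w.v (algebraMap K L x) = v.v x)
    {a c : L}
    (hdeg : Module.finrank K (IntermediateField.adjoin K {c}) <
      Module.finrank K (IntermediateField.adjoin K {a})) :
    ∃ a' : L, IsConjRoot K a a' ∧ a ≠ a' ∧ w.v (a - c) ≤ w.v (a - a') := by
  let := v.nontriviallyNormedField h
  let := w.absVal.toNormedField
  let := v.normedAlgebra h w hext
  have := v.completeSpace h hcomplete
  have := v.isUltrametricDist h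
  obtain ⟨a', h1, h2, h3⟩ := exists_isConjRoot_norm_sub_le hdeg
  exact ⟨a', h1, h2, w.absVal_le_iff.mp h3⟩

/-- The values `w (a - c)`, for `c` of smaller degree than `a`, are bounded above. -/
theorem exists_bound_v_sub [CharZero K] [IsAlgClosed L]
    (h : ∃ π : K, v.v π = ((1 : ℚ) : WithTop ℚ))
    (hcomplete : ∀ s : ℕ → K, v.IsCauchySeq s → ∃ l : K, v.TendsToVal s l)
    (w : AddVal L) (hext : ∀ x : K, w.v (algebraMap K L x) = v.v x)
    (a : L) :
    ∃ β : ℚ, ∀ c : L, Module.finrank K (IntermediateField.adjoin K {c}) <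
      Module.finrank K (IntermediateField.adjoin K {a}) → w.v (a - c) ≤ β := by
  have hfin : ((fun a' => (w.v (a - a')).untopD 0) '' (minpoly K a).rootSet L).Finite :=
    ((minpoly K a).rootSet_finite L).image _
  obtain ⟨β, hβ⟩ := hfin.bddAbove
  refine ⟨β, fun c hc => ?_⟩
  obtain ⟨a', hconj, hne, hle⟩ := v.exists_isConjRoot_v_sub_le h hcomplete w hext hc
  refine hle.trans ?_
  obtain ⟨q, hq⟩ := w.exists_coe (sub_ne_zero.mpr hne)
  have hmem : a' ∈ (minpoly K a).rootSet L :=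
    (isConjRoot_iff_mem_minpoly_rootSet (Algebra.IsIntegral.isIntegral a)).mp hconj
  have := hβ (Set.mem_image_of_mem _ hmem)
  rw [hq] at this ⊢
  exact_mod_cast this

/-- Elements of bounded degree have values in a discrete subgroup. -/
theorem exists_int_v_eq_div_factorial
    (h : ∃ π : K, v.v π = ((1 : ℚ) : WithTop ℚ))
    (hcomplete : ∀ s : ℕ → K, v.IsCauchySeq s → ∃ l : K, v.TendsToVal s l)
    (w : AddVal L) (hext : ∀ x : K, w.v (algebraMap K L x) = v.v x)
    (hdiscrete : ∀ x : K, x ≠ 0 → ∃ k : ℤ, v.v x = ((k : ℚ) : WithTop ℚ))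
    {x : L} (hx : x ≠ 0) {N : ℕ} (hN : (minpoly K x).natDegree ≤ N) :
    ∃ k : ℤ, w.v x = ((k / N.factorial : ℚ) : WithTop ℚ) := by
  have hint : IsIntegral K x := Algebra.IsIntegral.isIntegral x
  have hd := minpoly.natDegree_pos hint
  obtain ⟨k, hk⟩ := hdiscrete _ (minpoly.coeff_zero_ne_zero hint hx)
  obtain ⟨q, hq⟩ := w.exists_coe hx
  obtain ⟨m, hm⟩ := Nat.dvd_factorial hd hN
  have hdeg := v.natDegree_nsmul_v h hcomplete w hext x
  rw [hk, hq, ← WithTop.coe_nsmul, WithTop.coe_inj, nsmul_eq_mul] at hdeg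
  refine ⟨m * k, ?_⟩
  rw [hq, WithTop.coe_inj, eq_div_iff (by positivity), hm]
  push_cast
  rw [← hdeg]
  ring

end Extension

end AddVal

/-- Let `(K, v)` be a field of characteristic `0`, complete with respect to a
rank-one discrete valuation `v`, let `K̄` be an algebraic closure of `K` and let `v̄` be the
(unique) extension of `v` to `K̄`.  Then for every `a ∈ K̄ \ K` the set
`{v̄ (a - c) : c ∈ K̄, [K(c):K] < [K(a):K]}` has a maximum; in particular
`δ_K(a)`, the supremum of this set, is attained at some `c₀` with `[K(c₀):K] < [K(a):K]`. -/
theorem stmt_0 (K : Type) [Field K] [CharZero K] (v : AddVal K)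
    (hdiscrete : ∀ x : K, x ≠ 0 → ∃ k : ℤ, v.v x = ((k : ℚ) : WithTop ℚ))
    (hrankone : ∃ π : K, v.v π = ((1 : ℚ) : WithTop ℚ))
    (hcomplete : ∀ s : ℕ → K, v.IsCauchySeq s → ∃ l : K, v.TendsToVal s l)
    (vbar : AddVal (AlgebraicClosure K))
    (hext : ∀ x : K, vbar.v (algebraMap K (AlgebraicClosure K) x) = v.v x)
    (a : AlgebraicClosure K) (ha : a ∉ (algebraMap K (AlgebraicClosure K)).range) :
    ∃ c₀ : AlgebraicClosure K,
      Module.finrank K ↥(IntermediateField.adjoin K {c₀}) <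
        Module.finrank K ↥(IntermediateField.adjoin K {a}) ∧
      ∀ c : AlgebraicClosure K,
        Module.finrank K ↥(IntermediateField.adjoin K {c}) <
          Module.finrank K ↥(IntermediateField.adjoin K {a}) →
        vbar.v (a - c) ≤ vbar.v (a - c₀) := by
  set n := Module.finrank K (IntermediateField.adjoin K {a}) with hn
  obtain ⟨β, hβ⟩ := v.exists_bound_v_sub hrankone hcomplete vbar hext a
  set M := (n * n).factorial
  have hMpos : (0 : ℚ) < M := by exact_mod_cast Nat.factorial_pos _
  have hval : ∀ c : AlgebraicClosure K, Module.finrank K (IntermediateField.adjoin K {c}) < n →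
      ∃ k : ℤ, vbar.v (a - c) = ((k / M : ℚ) : WithTop ℚ) := fun c hc =>
    v.exists_int_v_eq_div_factorial hrankone hcomplete vbar hext hdiscrete
      (sub_ne_zero.mpr fun hac => hc.ne (by rw [hn, hac]))
      ((natDegree_minpoly_sub_le a c).trans (Nat.mul_le_mul_left _ hc.le))
  have hzero : Module.finrank K (IntermediateField.adjoin K {(0 : AlgebraicClosure K)}) < n := by
    have hint : IsIntegral K a := Algebra.IsIntegral.isIntegral a
    rw [IntermediateField.adjoin_zero, IntermediateField.finrank_bot, hn,
      IntermediateField.adjoin.finrank hint, ← Nat.succ_le_iff]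
    exact (minpoly.two_le_natDegree_iff hint).mpr ha
  obtain ⟨k₀, ⟨c₀, hc₀, hk₀⟩, hmax⟩ := Int.exists_greatest_of_bdd
    (P := fun k => ∃ c : AlgebraicClosure K,
      Module.finrank K (IntermediateField.adjoin K {c}) < n ∧
        vbar.v (a - c) = ((k / M : ℚ) : WithTop ℚ))
    ⟨⌊β * M⌋, fun k ⟨c, hc, hk⟩ => by
      have := hβ c hc
      rw [hk, WithTop.coe_le_coe, div_le_iff₀ hMpos] at this
      exact Int.le_floor.mpr this⟩
    ((hval 0 hzero).imp fun k hk => ⟨0, hzero, hk⟩)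
  refine ⟨c₀, hc₀, fun c hc => ?_⟩
  obtain ⟨k, hk⟩ := hval c hc
  rw [hk, hk₀, WithTop.coe_le_coe, div_le_div_iff_of_pos_right hMpos]
  exact_mod_cast hmax k ⟨c, hc, hk⟩

end
end

section
/- Every stacked sequence E ⊂ Q̄_p is a pseudo-convergent sequence of transcendental type; in particular, E has no pseudo-limit in Q̄_p (there is no α ∈ Q̄_p for which v_p(s_n − α) is strictly increasing in n). -/
open Polynomial Filter

noncomputable section

/-- A fixed algebraic closure of `ℚ_p`. -/
abbrev Qpbar (p : ℕ) [Fact p.Prime] : Type := AlgebraicClosure ℚ_[p]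

/-- The unique extension of the `p`-adic valuation to the algebraic closure of `ℚ_p`,
presented as an additive `ℚ`-valued valuation extending `Padic.valuation`. -/
structure PadicSetup (p : ℕ) [Fact p.Prime] where
  vbar : AddVal (Qpbar p)
  vbar_extends : ∀ x : ℚ_[p], x ≠ 0 →
    vbar.v (algebraMap ℚ_[p] (Qpbar p) x) = ((x.valuation : ℚ) : WithTop ℚ)

/-- A model of `ℂ_p`: a complete valued field in which `Q̄_p` embeds isometrically
and densely. -/
structure CpSetup (p : ℕ) [Fact p.Prime] extends PadicSetup p where
  Cp : Type
  [fieldCp : Field Cp]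
  emb : Qpbar p →+* Cp
  vC : AddVal Cp
  vC_emb : ∀ x : Qpbar p, vC.v (emb x) = vbar.v x
  complete : ∀ s : ℕ → Cp, vC.IsCauchySeq s → ∃ l : Cp, vC.TendsToVal s l
  dense : ∀ y : Cp, ∃ s : ℕ → Qpbar p, vC.TendsToVal (fun n => emb (s n)) y

attribute [instance] CpSetup.fieldCp

variable (p : ℕ) [Fact p.Prime]

/-- The degree `[ℚ_p(x) : ℚ_p]` of an element of the algebraic closure of `ℚ_p`. -/
def degOf (x : Qpbar p) : ℕ :=
  Module.finrank ℚ_[p] ↥(IntermediateField.adjoin ℚ_[p] {x})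

/-- A stacked sequence in `Q̄_p`: `s 0 ∈ ℚ_p`, the degrees `[ℚ_p(s n) : ℚ_p]` are strictly
increasing, and each `(s n, v (s (n+1) - s n))` is a minimal pair. -/
structure IsStacked (S : PadicSetup p) (s : ℕ → Qpbar p) : Prop where
  first : ∃ c : ℚ_[p], s 0 = algebraMap ℚ_[p] (Qpbar p) c
  deg_lt : ∀ n : ℕ, degOf p (s n) < degOf p (s (n + 1))
  min_pair : ∀ n : ℕ, ∀ c : Qpbar p, degOf p c < degOf p (s n) →
    S.vbar.v (s n - c) < S.vbar.v (s (n + 1) - s n)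

/-- A strongly stacked sequence: moreover each pair `(s n, s (n+1))` is distinguished. -/
structure IsStronglyStacked (S : PadicSetup p) (s : ℕ → Qpbar p) extends
    IsStacked p S s : Prop where
  dist : ∀ n : ℕ, ∀ c : Qpbar p, degOf p c < degOf p (s (n + 1)) →
    S.vbar.v (s (n + 1) - c) ≤ S.vbar.v (s (n + 1) - s n)

/-- The canonical map `ℚ → Q̄_p`. -/
def qHomQpbar : ℚ →+* Qpbar p :=
  (algebraMap ℚ_[p] (Qpbar p)).comp (Rat.castHom ℚ_[p])

/-- The ring `ℤ_{p,E}` (as a subset of `ℚ_p(X)`) attached to a sequence `E ⊆ Q̄_p`: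
rational functions mapping almost all the `s n` into `Z̄_p`. -/
def ZpE (S : PadicSetup p) (s : ℕ → Qpbar p) : Set (RatFunc ℚ_[p]) :=
  {φ : RatFunc ℚ_[p] | ∀ᶠ n in atTop,
    φ.denom.eval₂ (algebraMap ℚ_[p] (Qpbar p)) (s n) ≠ 0 ∧
      0 ≤ S.vbar.v (φ.eval (algebraMap ℚ_[p] (Qpbar p)) (s n))}

/-- The ring `ℤ_{(p),E}` (as a subset of `ℚ(X)`) attached to a sequence `E ⊆ Q̄_p`. -/
def ZplE (S : PadicSetup p) (s : ℕ → Qpbar p) : Set (RatFunc ℚ) :=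
  {φ : RatFunc ℚ | ∀ᶠ n in atTop,
    φ.denom.eval₂ (qHomQpbar p) (s n) ≠ 0 ∧
      0 ≤ S.vbar.v (φ.eval (qHomQpbar p) (s n))}

/-- `W` is a residually algebraic torsion extension of `ℤ_p` to `ℚ_p(X)`:
`W ∩ ℚ_p = ℤ_p`, the residue field of `W` is algebraic over `𝔽_p`, and the value group of `W`
is contained in the divisible hull of the value group of `ℤ_p`. -/
def IsResAlgTorsionQp (W : ValuationSubring (RatFunc ℚ_[p])) : Prop :=
  (∀ c : ℚ_[p], RatFunc.C c ∈ W ↔ ‖c‖ ≤ 1) ∧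
  (∀ x : IsLocalRing.ResidueField W, ∃ k : ℕ, 1 ≤ k ∧ x ^ p ^ k = x) ∧
  (∀ φ : RatFunc ℚ_[p], φ ≠ 0 → ∃ n : ℕ, 1 ≤ n ∧ ∃ c : ℚ_[p], c ≠ 0 ∧
    φ ^ n / RatFunc.C c ∈ W ∧ RatFunc.C c / φ ^ n ∈ W)

/-- `W` is a residually algebraic torsion extension of `ℤ_(p)` to `ℚ(X)`. -/
def IsResAlgTorsionQ (W : ValuationSubring (RatFunc ℚ)) : Prop :=
  (∀ c : ℚ, RatFunc.C c ∈ W ↔ ‖(c : ℚ_[p])‖ ≤ 1) ∧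
  (∀ x : IsLocalRing.ResidueField W, ∃ k : ℕ, 1 ≤ k ∧ x ^ p ^ k = x) ∧
  (∀ φ : RatFunc ℚ, φ ≠ 0 → ∃ n : ℕ, 1 ≤ n ∧ ∃ c : ℚ, c ≠ 0 ∧
    φ ^ n / RatFunc.C c ∈ W ∧ RatFunc.C c / φ ^ n ∈ W)

/-- The set of (rational) values of the valuation on an intermediate field of `Q̄_p/ℚ_p`. -/
def valSetF (S : PadicSetup p) (F : IntermediateField ℚ_[p] (Qpbar p)) : Set ℚ :=
  {γ : ℚ | ∃ a ∈ F, S.vbar.v a = (γ : WithTop ℚ)}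

/-- The value group (as a set of rationals) of `ℚ_p(x)` for `x ∈ Q̄_p`. -/
def valSetElem (S : PadicSetup p) (x : Qpbar p) : Set ℚ :=
  valSetF p S (IntermediateField.adjoin ℚ_[p] {x})

/-- The residue field of `F` is contained in the residue field of `F'` (inside the residue
field of `Z̄_p`). -/
def resSub (S : PadicSetup p) (F F' : IntermediateField ℚ_[p] (Qpbar p)) : Prop :=
  ∀ a ∈ F, 0 ≤ S.vbar.v a → ∃ b ∈ F', 0 ≤ S.vbar.v b ∧ 0 < S.vbar.v (a - b)

/-- A subset `Γ ⊆ ℚ` (a value group) has bounded denominators, i.e. finite ramification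
over `ℤ`. -/
def HasFiniteRamification (Γ : Set ℚ) : Prop :=
  ∃ e : ℕ, 0 < e ∧ ∀ γ ∈ Γ, ∃ k : ℤ, (e : ℚ) * γ = (k : ℚ)

/-- The ramification index of `Γ₁` over `Γ₀`: the least positive integer `e` with
`e • Γ₁ ⊆ Γ₀` (for the value groups of finite extensions of `ℚ_p` this is the index
`[Γ₁ : Γ₀]`). -/
def ramIdx (Γ₀ Γ₁ : Set ℚ) : ℕ :=
  sInf {e : ℕ | 0 < e ∧ ∀ γ ∈ Γ₁, (e : ℚ) * γ ∈ Γ₀}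

/-- The value group of `ℚ_p` (normalized): the integers, as a subset of `ℚ`. -/
def zSet : Set ℚ := Set.range ((↑) : ℤ → ℚ)

/-- The maximal unramified extension of a finite extension `K` of `ℚ_p` inside `Q̄_p`:
the set of `x` with `K(x)/K` unramified. -/
def maxUnramified (S : PadicSetup p) (K : IntermediateField ℚ_[p] (Qpbar p)) :
    Set (Qpbar p) :=
  {x : Qpbar p | valSetF p S (K ⊔ IntermediateField.adjoin ℚ_[p] {x}) = valSetF p S K}

section CpDefs

variable (S : CpSetup p)

/-- The canonical map `ℚ_p → ℂ_p`. -/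
def qpHomC : ℚ_[p] →+* S.Cp :=
  S.emb.comp (algebraMap ℚ_[p] (Qpbar p))

/-- The canonical map `ℚ → ℂ_p`. -/
def qHomC : ℚ →+* S.Cp :=
  (qpHomC p S).comp (Rat.castHom ℚ_[p])

/-- The valuation domain `ℤ_{p,α} = {φ ∈ ℚ_p(X) : φ(α) ∈ O_p}` (as a subset of `ℚ_p(X)`). -/
def Zpa (α : S.Cp) : Set (RatFunc ℚ_[p]) :=
  {φ : RatFunc ℚ_[p] | φ.denom.eval₂ (qpHomC p S) α ≠ 0 ∧
    0 ≤ S.vC.v (φ.eval (qpHomC p S) α)}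

/-- The valuation domain `ℤ_{(p),α} = {φ ∈ ℚ(X) : φ(α) ∈ O_p}` (as a subset of `ℚ(X)`). -/
def Zpla (α : S.Cp) : Set (RatFunc ℚ) :=
  {φ : RatFunc ℚ | φ.denom.eval₂ (qHomC p S) α ≠ 0 ∧
    0 ≤ S.vC.v (φ.eval (qHomC p S) α)}

/-- Membership in the subfield `ℚ_p(α)` of `ℂ_p`. -/
def InQpAlpha (α x : S.Cp) : Prop :=
  ∃ f g : Polynomial ℚ_[p], g.eval₂ (qpHomC p S) α ≠ 0 ∧
    x = f.eval₂ (qpHomC p S) α / g.eval₂ (qpHomC p S) α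

/-- The value group `Γ_α ⊆ ℚ` of `ℚ_p(α) ⊆ ℂ_p`. -/
def valSetCp (α : S.Cp) : Set ℚ :=
  {γ : ℚ | ∃ x : S.Cp, InQpAlpha p S α x ∧ S.vC.v x = (γ : WithTop ℚ)}

/-- The residue field `k_α` of `O_{p,α} = O_p ∩ ℚ_p(α)` is finite. -/
def ResFieldFiniteCp (α : S.Cp) : Prop :=
  ∃ T : Finset S.Cp, ∀ x : S.Cp, InQpAlpha p S α x → 0 ≤ S.vC.v x →
    ∃ a ∈ T, 0 < S.vC.v (x - a)

/-- `α` and `β` are conjugate over `ℚ_p`: some element of `Gal(Q̄_p/ℚ_p)`, extended to its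
unique continuous (equivalently, isometric) automorphism of `ℂ_p`, maps `α` to `β`. -/
def ConjCp (α β : S.Cp) : Prop :=
  ∃ σ : S.Cp →+* S.Cp, (∀ c : ℚ_[p], σ (qpHomC p S c) = qpHomC p S c) ∧
    (∀ x : Qpbar p, ∃ y : Qpbar p, σ (S.emb x) = S.emb y) ∧
    (∀ x : S.Cp, S.vC.v (σ x) = S.vC.v x) ∧ σ α = β

end CpDefs



namespace AddVal

variable {K : Type} [Field K] (w : AddVal K)

lemma v_neg_one : w.v (-1) = 0 := by
  have h1 : w.v 1 ≠ ⊤ := fun h => one_ne_zero ((w.v_eq_top_iff 1).1 h)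
  have h2 : w.v (-1) ≠ ⊤ := fun h => by simpa using (w.v_eq_top_iff (-1)).1 h
  have e1 := w.v_mul 1 1
  have e2 := w.v_mul (-1) (-1)
  rw [mul_one] at e1
  rw [neg_one_mul, neg_neg] at e2
  lift w.v 1 to ℚ using h1 with a
  lift w.v (-1) to ℚ using h2 with b
  norm_cast at e1 e2 ⊢
  linarith

lemma v_neg (x : K) : w.v (-x) = w.v x := by
  rw [neg_eq_neg_one_mul, v_mul, v_neg_one, zero_add]

lemma v_sub_comm (x y : K) : w.v (x - y) = w.v (y - x) := by
  rw [← neg_sub, v_neg]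

lemma v_add_eq_of_lt {x y : K} (h : w.v x < w.v y) : w.v (x + y) = w.v x := by
  refine le_antisymm ?_ (by simpa [h.le] using w.min_le_v_add x y)
  by_contra! hlt
  have := w.min_le_v_add (x + y) (-y)
  rw [add_neg_cancel_right, v_neg] at this
  exact absurd this (not_le.2 (lt_min hlt h))

variable {w} {s : ℕ → K}

lemma v_sub_eq_of_strictMono (hs : StrictMono fun n => w.v (s (n + 1) - s n)) {n m : ℕ}
    (h : n < m) : w.v (s m - s n) = w.v (s (n + 1) - s n) := by
  induction m, h using Nat.le_induction with
  | base => rfl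
  | succ m hm ih =>
    have hlt : w.v (s m - s n) < w.v (s (m + 1) - s m) := ih ▸ hs (Nat.lt_of_succ_le hm)
    rw [← ih, ← w.v_add_eq_of_lt hlt, sub_add_sub_cancel']

lemma isPseudoConvergent_of_strictMono (hs : StrictMono fun n => w.v (s (n + 1) - s n)) :
    w.IsPseudoConvergent s := by
  intro n m k hnm hmk
  rw [w.v_sub_comm (s n), w.v_sub_comm (s m) (s k), v_sub_eq_of_strictMono hs hnm,
    v_sub_eq_of_strictMono hs hmk]
  exact hs hnm

/-- A sequence over an algebraically closed field is of transcendental type as soon as this can be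
checked on linear polynomials. -/
lemma isTranscendentalType_of_linear [IsAlgClosed K]
    (h : ∀ α : K, ∃ N : ℕ, ∀ m ≥ N, ∀ n ≥ N, w.v (s m - α) = w.v (s n - α)) :
    w.IsTranscendentalType s := by
  intro f
  have key : ∀ t : Multiset K, ∃ N : ℕ, ∀ m ≥ N, ∀ n ≥ N,
      w.v ((t.map fun a => X - C a).prod.eval (s m)) =
        w.v ((t.map fun a => X - C a).prod.eval (s n)) := by
    intro t
    induction t using Multiset.induction_on with
    | empty => simp
    | cons a t ih =>
      obtain ⟨N, hN⟩ := ih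
      obtain ⟨M, hM⟩ := h a
      refine ⟨max M N, fun m hm n hn => ?_⟩
      simp only [Multiset.map_cons, Multiset.prod_cons, eval_mul, eval_sub, eval_X, eval_C, v_mul]
      rw [hM m (le_of_max_le_left hm) n (le_of_max_le_left hn),
        hN m (le_of_max_le_right hm) n (le_of_max_le_right hn)]
  obtain ⟨N, hN⟩ := key f.roots
  refine ⟨N, fun m hm n hn => ?_⟩
  rw [(IsAlgClosed.splits f).eq_prod_roots]
  simp only [← eval₂_id, eval₂_mul, eval₂_C, v_mul] at hN ⊢
  rw [hN m hm n hn]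

end AddVal

namespace IsStacked

variable {p} {S : PadicSetup p} {s : ℕ → Qpbar p}

lemma strictMono_v (hs : IsStacked p S s) :
    StrictMono fun n => S.vbar.v (s (n + 1) - s n) :=
  strictMono_nat_of_lt_succ fun n => hs.min_pair (n + 1) (s n) (hs.deg_lt n)

lemma v_sub_lt (hs : IsStacked p S s) {α : Qpbar p} {n : ℕ} (hn : degOf p α < n) :
    S.vbar.v (s n - α) < S.vbar.v (s (n + 1) - s n) :=
  hs.min_pair n α (hn.trans_le ((strictMono_nat_of_lt_succ hs.deg_lt).le_apply))

lemma v_succ_sub_eq (hs : IsStacked p S s) {α : Qpbar p} {n : ℕ} (hn : degOf p α < n) :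
    S.vbar.v (s (n + 1) - α) = S.vbar.v (s n - α) := by
  rw [← S.vbar.v_add_eq_of_lt (hs.v_sub_lt hn), sub_add_sub_cancel']

lemma v_sub_eventually_const (hs : IsStacked p S s) (α : Qpbar p) :
    ∃ N : ℕ, ∀ m ≥ N, ∀ n ≥ N, S.vbar.v (s m - α) = S.vbar.v (s n - α) := by
  have key : ∀ m ≥ degOf p α + 1,
      S.vbar.v (s m - α) = S.vbar.v (s (degOf p α + 1) - α) := by
    intro m hm
    induction m, hm using Nat.le_induction with
    | base => rfl
    | succ m hm ih => rw [hs.v_succ_sub_eq hm, ih]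
  exact ⟨degOf p α + 1, fun m hm n hn => (key m hm).trans (key n hn).symm⟩

end IsStacked

/-- Every stacked sequence `E ⊆ Q̄_p` is a pseudo-convergent sequence of
transcendental type; in particular, `E` has no pseudo-limit in `Q̄_p`. -/
theorem stmt_1 (p : ℕ) [Fact p.Prime] (S : PadicSetup p) (s : ℕ → Qpbar p)
    (hs : IsStacked p S s) :
    S.vbar.IsPseudoConvergent s ∧ S.vbar.IsTranscendentalType s ∧
      ∀ α : Qpbar p, ¬ S.vbar.IsPseudoLimit s α := by
  refine ⟨AddVal.isPseudoConvergent_of_strictMono hs.strictMono_v,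
    AddVal.isTranscendentalType_of_linear hs.v_sub_eventually_const, fun α hα => ?_⟩
  obtain ⟨N, hN⟩ := hs.v_sub_eventually_const α
  exact (hα N.lt_succ_self).ne (hN N le_rfl (N + 1) N.le_succ)

end
end

section
/- Let E = {s_n}_{n∈ℕ} ⊂ Q̄_p be a stacked sequence and let W = ℤ_{p,E}, with associated valuation w, value group Γ_w and residue field k_w. Then Γ_w = ∪_{n∈ℕ} Γ_n and k_w = ∪_{n∈ℕ} k_n, where Γ_n and k_n are the value group and residue field of the valuation ring Z̄_p ∩ ℚ_p(s_n) of ℚ_p(s_n). -/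
open Polynomial Filter

noncomputable section

variable (p : ℕ) [Fact p.Prime]

namespace AddVal

variable {K : Type} [Field K] (w : AddVal K)

lemma v_zero_s4 : w.v 0 = ⊤ := (w.v_eq_top_iff 0).2 rfl

lemma v_one : w.v 1 = 0 := by
  have h := w.v_mul 1 1
  have h1 : w.v 1 ≠ ⊤ := fun h => one_ne_zero ((w.v_eq_top_iff 1).1 h)
  rw [mul_one] at h
  lift w.v 1 to ℚ using h1 with x
  norm_cast at h ⊢
  linarith

lemma v_inv_add {x : K} (hx : x ≠ 0) : w.v x⁻¹ + w.v x = 0 := by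
  rw [← w.v_mul, inv_mul_cancel₀ hx, w.v_one]

lemma ne_zero_of_v_lt {b c : K} (h : w.v b < w.v c) : b ≠ 0 := by
  rintro rfl
  rw [w.v_zero_s4] at h
  exact not_top_lt h

/-- If `a` is strictly closer to `b` than `b` is to `0`, then `a` and `b` have equal values. -/
lemma v_eq_of_lt_sub {a b : K} (h : w.v b < w.v (a - b)) : w.v a = w.v b := by
  have h1 := w.min_le_v_add (a - b) b
  rw [sub_add_cancel, min_eq_right h.le] at h1
  refine le_antisymm (le_of_not_gt fun h2 => ?_) h1
  have h3 := w.min_le_v_add a (b - a)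
  rw [add_sub_cancel, w.v_sub_comm] at h3
  exact absurd h3 (not_le.2 (lt_min h2 h))

lemma lt_sub_mul {a b a' b' : K} (h : w.v b < w.v (a - b)) (h' : w.v b' < w.v (a' - b')) :
    w.v (b * b') < w.v (a * a' - b * b') := by
  have hb : w.v b ≠ ⊤ := h.ne_top
  have hb' : w.v b' ≠ ⊤ := h'.ne_top
  have e : a * a' - b * b' = a * (a' - b') + (a - b) * b' := by ring
  rw [e]
  refine lt_of_lt_of_le (lt_min ?_ ?_) (w.min_le_v_add _ _)
  · rw [w.v_mul, w.v_mul, w.v_eq_of_lt_sub h]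
    exact WithTop.add_lt_add_left hb h'
  · rw [w.v_mul, w.v_mul]
    exact WithTop.add_lt_add_right hb' h

lemma lt_sub_inv {a b : K} (h : w.v b < w.v (a - b)) : w.v b⁻¹ < w.v (a⁻¹ - b⁻¹) := by
  have hb : b ≠ 0 := w.ne_zero_of_v_lt h
  have hab := w.v_eq_of_lt_sub h
  have ha : a ≠ 0 := fun h0 => hb <| by
    rwa [h0, w.v_zero_s4, eq_comm, w.v_eq_top_iff] at hab
  by_contra! hc
  refine absurd h (not_lt.2 ?_)
  have e : a - b = -((a⁻¹ - b⁻¹) * (b * a)) := by field_simp; ring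
  rw [e, w.v_neg, w.v_mul, w.v_mul, hab]
  calc _ ≤ w.v b⁻¹ + (w.v b + w.v b) := by gcongr
    _ = w.v b := by rw [← add_assoc, w.v_inv_add hb, zero_add]

/-- If `a` is closer to `b` than every root of the split polynomial `f`, then `f a` and `f b`
have the same leading term. -/
lemma lt_sub_eval {f : Polynomial K} (hf : f.Splits) (h0 : f ≠ 0) {a b : K}
    (hr : ∀ r ∈ f.roots, w.v (b - r) < w.v (a - b)) :
    w.v (f.eval b) < w.v (f.eval a - f.eval b) := by
  have key : ∀ R : Multiset K, (∀ r ∈ R, w.v (b - r) < w.v (a - b)) →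
      w.v (R.map (b - ·)).prod < w.v ((R.map (a - ·)).prod - (R.map (b - ·)).prod) := by
    intro R
    induction R using Multiset.induction_on with
    | empty => simp [w.v_one, w.v_zero_s4]
    | cons r R ih =>
      intro hR
      simp only [Multiset.map_cons, Multiset.prod_cons]
      refine w.lt_sub_mul ?_ (ih fun x hx => hR x (Multiset.mem_cons_of_mem hx))
      rw [sub_sub_sub_cancel_right]
      exact hR r (Multiset.mem_cons_self r R)
  have hlead : w.v f.leadingCoeff < w.v (f.leadingCoeff - f.leadingCoeff) := by
    rw [sub_self, w.v_zero_s4, lt_top_iff_ne_top, Ne, w.v_eq_top_iff]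
    exact leadingCoeff_ne_zero.2 h0
  rw [hf.eval_eq_prod_roots, hf.eval_eq_prod_roots]
  exact w.lt_sub_mul hlead (key _ hr)

end AddVal

section Stacked

variable {p} {S : PadicSetup p} {s : ℕ → Qpbar p}

lemma degOf_le_natDegree {f : Polynomial ℚ_[p]} (hf : f ≠ 0) {r : Qpbar p}
    (hr : aeval r f = 0) : degOf p r ≤ f.natDegree := by
  rw [degOf, IntermediateField.adjoin.finrank (Algebra.IsIntegral.isIntegral r)]
  exact natDegree_le_of_dvd (minpoly.dvd _ _ hr) hf

lemma exists_polynomial_of_mem_adjoin {x a : Qpbar p}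
    (ha : a ∈ IntermediateField.adjoin ℚ_[p] {x}) :
    ∃ f : Polynomial ℚ_[p], f.natDegree < degOf p x ∧ aeval x f = a := by
  have hx : IsIntegral ℚ_[p] x := Algebra.IsIntegral.isIntegral x
  rw [← IntermediateField.mem_toSubalgebra,
    IntermediateField.adjoin_simple_toSubalgebra_of_isAlgebraic hx.isAlgebraic,
    Algebra.adjoin_singleton_eq_range_aeval] at ha
  obtain ⟨g, rfl⟩ := ha
  refine ⟨g %ₘ minpoly ℚ_[p] x, ?_, ?_⟩
  · rw [degOf, IntermediateField.adjoin.finrank hx]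
    exact natDegree_modByMonic_lt _ (minpoly.monic hx) (minpoly.ne_one _ _)
  · exact aeval_modByMonic_eq_self_of_root (minpoly.aeval _ _)

namespace IsStacked

lemma le_degOf (hs : IsStacked p S s) (n : ℕ) : n ≤ degOf p (s n) :=
  (strictMono_nat_of_lt_succ hs.deg_lt).le_apply

lemma v_sub_succ_lt (hs : IsStacked p S s) (n : ℕ) :
    S.vbar.v (s (n + 1) - s n) < S.vbar.v (s (n + 2) - s (n + 1)) :=
  hs.min_pair (n + 1) (s n) (hs.deg_lt n)

lemma v_sub_succ_le_v_sub (hs : IsStacked p S s) {n m : ℕ} (h : n ≤ m) :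
    S.vbar.v (s (n + 1) - s n) ≤ S.vbar.v (s m - s n) := by
  induction m, h using Nat.le_induction with
  | base => simp [S.vbar.v_zero_s4]
  | succ m h ih =>
    have e : s (m + 1) - s n = (s (m + 1) - s m) + (s m - s n) := by ring
    rw [e]
    exact (le_min ((strictMono_nat_of_lt_succ hs.v_sub_succ_lt).monotone h) ih).trans
      (S.vbar.min_le_v_add _ _)

/-- The values of a polynomial of degree less than `[ℚ_p(s n) : ℚ_p]` at the terms `s m`,
`n ≤ m`, all have the same leading term. -/
lemma lt_sub_aeval (hs : IsStacked p S s) {n m : ℕ} (h : n ≤ m) {f : Polynomial ℚ_[p]}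
    (h0 : f ≠ 0) (hf : f.natDegree < degOf p (s n)) :
    S.vbar.v (aeval (s n) f) < S.vbar.v (aeval (s m) f - aeval (s n) f) := by
  rw [← eval_map_algebraMap, ← eval_map_algebraMap]
  have hmap : f.map (algebraMap ℚ_[p] (Qpbar p)) ≠ 0 := by
    simpa [Polynomial.map_eq_zero] using h0
  refine S.vbar.lt_sub_eval (IsAlgClosed.splits _) hmap fun r hr => ?_
  rw [mem_roots hmap, IsRoot.def, eval_map_algebraMap] at hr
  exact (hs.min_pair n r ((degOf_le_natDegree h0 hr).trans_lt hf)).trans_le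
    (hs.v_sub_succ_le_v_sub h)

lemma lt_sub_ratFunc_eval (hs : IsStacked p S s) {n m : ℕ} (h : n ≤ m) {φ : RatFunc ℚ_[p]}
    (h0 : φ ≠ 0) (hnum : φ.num.natDegree < degOf p (s n))
    (hden : φ.denom.natDegree < degOf p (s n)) :
    S.vbar.v (φ.eval (algebraMap ℚ_[p] (Qpbar p)) (s n)) <
      S.vbar.v (φ.eval (algebraMap ℚ_[p] (Qpbar p)) (s m) -
        φ.eval (algebraMap ℚ_[p] (Qpbar p)) (s n)) := by
  simp only [RatFunc.eval, div_eq_mul_inv]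
  exact S.vbar.lt_sub_mul (hs.lt_sub_aeval h (RatFunc.num_ne_zero h0) hnum)
    (S.vbar.lt_sub_inv (hs.lt_sub_aeval h φ.denom_ne_zero hden))

lemma exists_lt_degOf (hs : IsStacked p S s) (φ : RatFunc ℚ_[p]) :
    ∃ n, φ.num.natDegree < degOf p (s n) ∧ φ.denom.natDegree < degOf p (s n) := by
  have h := hs.le_degOf (φ.num.natDegree + φ.denom.natDegree + 1)
  exact ⟨φ.num.natDegree + φ.denom.natDegree + 1, by omega, by omega⟩

end IsStacked

lemma ratFunc_eval_mem_adjoin (φ : RatFunc ℚ_[p]) (x : Qpbar p) :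
    φ.eval (algebraMap ℚ_[p] (Qpbar p)) x ∈ IntermediateField.adjoin ℚ_[p] {x} := by
  have hx := IntermediateField.mem_adjoin_simple_self ℚ_[p] x
  have h : ∀ f : Polynomial ℚ_[p], aeval x f ∈ IntermediateField.adjoin ℚ_[p] {x} := fun f =>
    Algebra.adjoin_le (S := (IntermediateField.adjoin ℚ_[p] {x}).toSubalgebra)
      (Set.singleton_subset_iff.2 hx) (aeval_mem_adjoin_singleton _ _)
  exact div_mem (h φ.num) (h φ.denom)

end Stacked

/-- Let `E = {s_n} ⊆ Q̄_p` be a stacked sequence and `W = ℤ_{p,E}`, with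
valuation `w`, value group `Γ_w` and residue field `k_w`.  Then `Γ_w = ⋃_n Γ_n` and
`k_w = ⋃_n k_n`, where `Γ_n` and `k_n` are the value group and the residue field of the
valuation ring `Z̄_p ∩ ℚ_p(s_n)` of `ℚ_p(s_n)`.  (The value of `w` at a nonzero `φ` is the
eventually constant value `v_p(φ(s_n))`; residues are compared inside the residue field of
`Z̄_p`: two elements have the same residue iff their difference has positive value.) -/
theorem stmt_4 (p : ℕ) [Fact p.Prime] (S : PadicSetup p) (s : ℕ → Qpbar p)
    (hs : IsStacked p S s) :
    -- the value group of `W` is the union of the value groups `Γ_n`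
    ({γ : ℚ | ∃ φ : RatFunc ℚ_[p], φ ≠ 0 ∧
        ∀ᶠ n in atTop,
          S.vbar.v (φ.eval (algebraMap ℚ_[p] (Qpbar p)) (s n)) = (γ : WithTop ℚ)}
      = ⋃ n : ℕ, valSetElem p S (s n)) ∧
    -- the residue field of `W` is contained in the union of the residue fields `k_n` …
    (∀ φ ∈ ZpE p S s, ∃ n : ℕ, ∃ a ∈ IntermediateField.adjoin ℚ_[p] {s n},
      0 ≤ S.vbar.v a ∧
        ∀ᶠ m in atTop,
          0 < S.vbar.v (φ.eval (algebraMap ℚ_[p] (Qpbar p)) (s m) - a)) ∧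
    -- … and conversely every residue of some `k_n` is the residue of an element of `W`
    (∀ n : ℕ, ∀ a ∈ IntermediateField.adjoin ℚ_[p] {s n}, 0 ≤ S.vbar.v a →
      ∃ φ ∈ ZpE p S s,
        ∀ᶠ m in atTop,
          0 < S.vbar.v (φ.eval (algebraMap ℚ_[p] (Qpbar p)) (s m) - a)) := by
  have eval_alg (f : Polynomial ℚ_[p]) (x : Qpbar p) :
      (algebraMap _ (RatFunc ℚ_[p]) f).eval (algebraMap ℚ_[p] (Qpbar p)) x = aeval x f := by
    rw [RatFunc.eval_algebraMap, aeval_def, Algebra.algebraMap_self, RingHom.id_apply]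
  refine ⟨?_, ?_, ?_⟩
  · ext γ
    simp only [Set.mem_ofPred_eq, Set.mem_iUnion, valSetElem, valSetF]
    constructor
    · rintro ⟨φ, -, h⟩
      obtain ⟨n, hn⟩ := h.exists
      exact ⟨n, _, ratFunc_eval_mem_adjoin φ (s n), hn⟩
    · rintro ⟨n, a, ha, hv⟩
      obtain ⟨f, hf, rfl⟩ := exists_polynomial_of_mem_adjoin ha
      have h0 : f ≠ 0 := by
        rintro rfl
        rw [map_zero, S.vbar.v_zero_s4] at hv
        exact WithTop.top_ne_coe hv
      refine ⟨algebraMap _ _ f, RatFunc.algebraMap_ne_zero h0, ?_⟩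
      filter_upwards [eventually_ge_atTop n] with m hm
      rw [eval_alg, S.vbar.v_eq_of_lt_sub (hs.lt_sub_aeval hm h0 hf), hv]
  · intro φ hφ
    obtain rfl | h0 := eq_or_ne φ 0
    · exact ⟨0, 0, zero_mem _, by simp [S.vbar.v_zero_s4], by simp [S.vbar.v_zero_s4]⟩
    obtain ⟨n, hnum, hden⟩ := hs.exists_lt_degOf φ
    have hlt (m : ℕ) (hm : n ≤ m) := hs.lt_sub_ratFunc_eval hm h0 hnum hden
    obtain ⟨m, ⟨-, hm⟩, hnm⟩ := (hφ.and (eventually_ge_atTop n)).exists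
    rw [S.vbar.v_eq_of_lt_sub (hlt m hnm)] at hm
    refine ⟨n, _, ratFunc_eval_mem_adjoin φ (s n), hm, ?_⟩
    filter_upwards [eventually_ge_atTop n] with k hk using hm.trans_lt (hlt k hk)
  · intro n a ha hv
    obtain ⟨f, hf, rfl⟩ := exists_polynomial_of_mem_adjoin ha
    have hlt (m : ℕ) (hm : n ≤ m) :
        0 < S.vbar.v (aeval (s m) f - aeval (s n) f) := by
      obtain rfl | h0 := eq_or_ne f 0
      · simp [S.vbar.v_zero_s4]
      · exact hv.trans_lt (hs.lt_sub_aeval hm h0 hf)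
    refine ⟨algebraMap _ _ f, ?_, ?_⟩
    · filter_upwards [eventually_ge_atTop n] with m hm
      refine ⟨by simp, ?_⟩
      rw [eval_alg, ← sub_add_cancel (aeval (s m) f) (aeval (s n) f)]
      exact (le_min (hlt m hm).le hv).trans (S.vbar.min_le_v_add _ _)
    · filter_upwards [eventually_ge_atTop n] with m hm
      rw [eval_alg]
      exact hlt m hm

end
end

section
/- Let W be a residually algebraic torsion extension of ℤ_p to ℚ_p(X), and let e = e(W|ℤ_p) be the ramification index (the index of the value group of ℤ_p in the value group of W) and f = f(W|ℤ_p) the residue field degree (the degree of the residue field of W over 𝔽_p). Then e·f = ∞, i.e., e and f are not both finite. -/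
open Polynomial Filter

noncomputable section

variable (p : ℕ) [Fact p.Prime]

theorem smodEq_pow_span_singleton_iff {R M : Type*} [CommRing R] [AddCommGroup M] [Module R M]
    (a : R) (n : ℕ) (x y : M) :
    x ≡ y [SMOD ((Ideal.span {a}) ^ n • ⊤ : Submodule R M)] ↔ ∃ z : M, a ^ n • z = x - y := by
  rw [SModEq.sub_mem, Ideal.span_singleton_pow, Submodule.ideal_span_singleton_smul,
    Submodule.mem_smul_pointwise_iff_exists]
  simp

theorem isPrecomplete_pi {R ι : Type*} [CommRing R] (a : R) [IsPrecomplete (Ideal.span {a}) R] :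
    IsPrecomplete (Ideal.span {a}) (ι → R) := by
  refine ⟨fun f hf => ?_⟩
  have key (i : ι) : ∃ l : R, ∀ n, f n i ≡ l [SMOD ((Ideal.span {a}) ^ n • ⊤ : Ideal R)] := by
    refine IsPrecomplete.prec' (fun n => f n i) fun {m n} hmn => ?_
    obtain ⟨z, hz⟩ := (smodEq_pow_span_singleton_iff a m _ _).1 (hf hmn)
    exact (smodEq_pow_span_singleton_iff a m _ _).2 ⟨z i, by simpa using congrFun hz i⟩
  choose l hl using key
  refine ⟨l, fun n => (smodEq_pow_span_singleton_iff a n _ _).2 ?_⟩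
  choose z hz using fun i => (smodEq_pow_span_singleton_iff a n _ _).1 (hl i n)
  exact ⟨z, funext hz⟩

/-- A form of Nakayama's lemma over a complete ring. -/
theorem Module.Finite.of_isHausdorff_of_finite_quotient {R M : Type*} [CommRing R]
    [AddCommGroup M] [Module R M] (a : R) [IsPrecomplete (Ideal.span {a}) R]
    [IsHausdorff (Ideal.span {a}) M]
    [Finite (M ⧸ (Ideal.span {a} • ⊤ : Submodule R M))] : Module.Finite R M := by
  let Q := M ⧸ (Ideal.span {a} • ⊤ : Submodule R M)
  have : Fintype Q := Fintype.ofFinite Q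
  have : IsPrecomplete (Ideal.span {a}) (Q → R) := isPrecomplete_pi a
  let f : (Q → R) →ₗ[R] M := Fintype.linearCombination R (fun q : Q => Quotient.out q)
  refine Module.Finite.of_surjective f
    (surjective_of_mkQ_comp_surjective (I := Ideal.span {a}) fun q => ?_)
  classical
  refine ⟨Pi.single q 1, ?_⟩
  simp only [f, LinearMap.comp_apply, Fintype.linearCombination_apply_single, one_smul]
  exact Quotient.out_eq q

theorem ValuationRing.maximalIdeal_fg_of_pow_le {V : Type*} [CommRing V] [IsDomain V]
    [ValuationRing V] {a : V} (ha : a ∈ IsLocalRing.maximalIdeal V) {n : ℕ}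
    (h : IsLocalRing.maximalIdeal V ^ n ≤ Ideal.span {a}) :
    (IsLocalRing.maximalIdeal V).FG := by
  set m := IsLocalRing.maximalIdeal V
  by_cases hm : m ≤ m ^ 2
  · have hmn (k : ℕ) : m ≤ m ^ (k + 1) := by
      induction k with
      | zero => simp
      | succ k ih =>
        calc m ≤ m ^ 2 := hm
          _ = m * m := sq m
          _ ≤ m ^ (k + 1) * m := Ideal.mul_mono_left ih
          _ = m ^ (k + 1 + 1) := (pow_succ _ _).symm
    have : m = Ideal.span {a} :=
      le_antisymm (((hmn n).trans (Ideal.pow_le_pow_right n.le_succ)).trans h)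
        ((Ideal.span_singleton_le_iff_mem _).2 ha)
    exact ⟨{a}, by simp [this]⟩
  · obtain ⟨π, hπ, hπ2⟩ := SetLike.not_le_iff_exists.1 hm
    refine ⟨{π}, ?_⟩
    rw [Finset.coe_singleton]
    refine le_antisymm ((Ideal.span_singleton_le_iff_mem _).2 hπ) fun x hx => ?_
    rw [Ideal.mem_span_singleton]
    rcases ValuationRing.dvd_total π x with hd | ⟨y, rfl⟩
    · exact hd
    · by_cases hy : IsUnit y
      · exact (hy.mul_right_dvd).2 dvd_rfl
      · exact absurd (sq m ▸ Ideal.mul_mem_mul hx ((IsLocalRing.mem_maximalIdeal y).2 hy)) hπ2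

theorem ValuationRing.finite_quotient_span_singleton {V : Type*} [CommRing V] [IsDomain V]
    [ValuationRing V] [Finite (IsLocalRing.ResidueField V)] {a : V}
    (ha : a ∈ IsLocalRing.maximalIdeal V) {n : ℕ}
    (h : IsLocalRing.maximalIdeal V ^ n ≤ Ideal.span {a}) :
    Finite (V ⧸ Ideal.span {a}) := by
  have : Finite (V ⧸ IsLocalRing.maximalIdeal V) :=
    inferInstanceAs (Finite (IsLocalRing.ResidueField V))
  have := Ideal.finite_quotient_pow (ValuationRing.maximalIdeal_fg_of_pow_le ha h) n
  exact Finite.of_surjective _ (Ideal.Quotient.factor_surjective h)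

/-- In a valuation ring, if the `n`-th power of every nonunit is divisible by `a`, then so is every
product of `n` nonunits. -/
theorem ValuationRing.maximalIdeal_pow_le_span_singleton {V : Type*} [CommRing V] [IsDomain V]
    [ValuationRing V] {a : V} {n : ℕ} (hn : n ≠ 0)
    (h : ∀ x ∈ IsLocalRing.maximalIdeal V, a ∣ x ^ n) :
    IsLocalRing.maximalIdeal V ^ n ≤ Ideal.span {a} := by
  rw [Submodule.pow_eq_span_pow_set, Submodule.span_le]
  rintro _ hx
  obtain ⟨f, rfl⟩ := Set.mem_pow.1 hx
  rw [SetLike.mem_coe, Ideal.mem_span_singleton, List.prod_ofFn,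
    ← IsIntegrallyClosed.pow_dvd_pow_iff hn, ← Finset.prod_pow]
  simpa using Finset.prod_dvd_prod_of_dvd (s := Finset.univ) (fun _ => a) _
    fun i _ => h (f i) (f i).2

theorem RatFunc.natCast_dvd_pow_of_mem_maximalIdeal {p : ℕ} [Fact p.Prime]
    {W : ValuationSubring (RatFunc ℚ_[p])} (hC : ∀ c : ℚ_[p], RatFunc.C c ∈ W ↔ ‖c‖ ≤ 1)
    {N : ℕ} (hN : 0 < N)
    (h : ∀ φ : RatFunc ℚ_[p], φ ≠ 0 → ∃ c : ℚ_[p], c ≠ 0 ∧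
      φ ^ N / RatFunc.C c ∈ W ∧ RatFunc.C c / φ ^ N ∈ W)
    {x : W} (hx : x ∈ IsLocalRing.maximalIdeal W) : (p : W) ∣ x ^ N := by
  have hp : (p : ℚ_[p]) ≠ 0 := by exact_mod_cast (Fact.out : p.Prime).ne_zero
  by_cases hx0 : x = 0
  · simp [hx0, hN.ne']
  have hx0' : (x : RatFunc ℚ_[p]) ≠ 0 := by simpa using hx0
  obtain ⟨c, hc, h1, h2⟩ := h x hx0'
  have hCc : RatFunc.C c ≠ 0 := by simpa using hc
  have hc1 : ‖c‖ < 1 := by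
    by_contra! hc1
    have hci : RatFunc.C c⁻¹ ∈ W := (hC _).2 (by rw [norm_inv]; exact inv_le_one_of_one_le₀ hc1)
    refine (IsLocalRing.mem_maximalIdeal x).1 hx (isUnit_of_dvd_one ?_)
    refine (dvd_pow_self x hN.ne').trans ⟨⟨_, W.mul_mem _ _ hci h2⟩, Subtype.ext ?_⟩
    push_cast
    rw [map_inv₀]
    field_simp
  have hcp : RatFunc.C (c / p) ∈ W := by
    rw [hC, norm_div, Padic.norm_p, div_inv_eq_mul]
    have := (Padic.norm_le_pow_iff_norm_lt_pow_add_one c (-1)).2 (by simpa using hc1)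
    rw [zpow_neg_one] at this
    have hp0 : (0 : ℝ) < p := by exact_mod_cast (Fact.out : p.Prime).pos
    calc ‖c‖ * p ≤ (p : ℝ)⁻¹ * p := by gcongr
      _ = 1 := inv_mul_cancel₀ hp0.ne'
  have hp' : (p : RatFunc ℚ_[p]) ≠ 0 := by
    rw [← map_natCast (RatFunc.C (K := ℚ_[p]))]; simpa using hp
  refine ⟨⟨_, W.mul_mem _ _ hcp h1⟩, Subtype.ext ?_⟩
  push_cast
  rw [map_div₀, map_natCast]
  field_simp

theorem RatFunc.eq_zero_of_forall_pow_dvd {p : ℕ} [Fact p.Prime]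
    {W : ValuationSubring (RatFunc ℚ_[p])} (hC : ∀ c : ℚ_[p], RatFunc.C c ∈ W ↔ ‖c‖ ≤ 1)
    {x : W} {N : ℕ} {c : ℚ_[p]} (hN : 0 < N) (hc : c ≠ 0)
    (h : RatFunc.C c / (x : RatFunc ℚ_[p]) ^ N ∈ W) (hx : ∀ n : ℕ, (p : W) ^ n ∣ x) : x = 0 := by
  by_contra hx0
  have hx0' : (x : RatFunc ℚ_[p]) ≠ 0 := by simpa using hx0
  have hp : (p : ℚ_[p]) ≠ 0 := by exact_mod_cast (Fact.out : p.Prime).ne_zero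
  have hp' : (p : RatFunc ℚ_[p]) ≠ 0 := by
    rw [← map_natCast (RatFunc.C (K := ℚ_[p]))]; simpa using hp
  have hle (n : ℕ) : ‖c‖ ≤ (p : ℝ)⁻¹ ^ n := by
    obtain ⟨z, hz⟩ := (hx n).trans (dvd_pow_self x hN.ne')
    have hz' : (x : RatFunc ℚ_[p]) ^ N = (p : RatFunc ℚ_[p]) ^ n * z := by
      simpa using congrArg (Subtype.val : W → RatFunc ℚ_[p]) hz
    have hz0 : (z : RatFunc ℚ_[p]) ≠ 0 := by
      rintro hz0
      rw [hz0, mul_zero] at hz'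
      exact pow_ne_zero N hx0' hz'
    have := W.mul_mem _ _ h z.2
    rw [hz'] at this
    have heq : RatFunc.C c / ((p : RatFunc ℚ_[p]) ^ n * z) * z = RatFunc.C (c / (p : ℚ_[p]) ^ n) := by
      rw [map_div₀, map_pow, map_natCast]
      field_simp
    rw [heq, hC, norm_div, norm_pow, Padic.norm_p] at this
    have hp0 : (0 : ℝ) < p := by exact_mod_cast (Fact.out : p.Prime).pos
    exact (div_le_one₀ (by positivity)).1 this
  have hlt : (p : ℝ)⁻¹ < 1 :=
    inv_lt_one_of_one_lt₀ (by exact_mod_cast (Fact.out : p.Prime).one_lt)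
  have := ge_of_tendsto' (tendsto_pow_atTop_nhds_zero_of_lt_one (by positivity) hlt) hle
  exact hc (norm_le_zero_iff.1 this)

/-- The inclusion of `ℤ_p` in a valuation ring of `ℚ_p(X)` lying over it. -/
def padicIntToSubring {p : ℕ} [Fact p.Prime] (W : ValuationSubring (RatFunc ℚ_[p]))
    (hC : ∀ c : ℚ_[p], RatFunc.C c ∈ W ↔ ‖c‖ ≤ 1) : ℤ_[p] →+* W :=
  (RatFunc.C.comp PadicInt.Coe.ringHom).codRestrict W.toSubring fun c => (hC c).2 c.2

theorem padicIntToSubring_not_finite {p : ℕ} [Fact p.Prime]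
    (W : ValuationSubring (RatFunc ℚ_[p]))
    (hC : ∀ c : ℚ_[p], RatFunc.C c ∈ W ↔ ‖c‖ ≤ 1) : ¬ (padicIntToSubring W hC).Finite := by
  intro hfin
  have halg (φ : RatFunc ℚ_[p]) (hφ : φ ∈ W) : IsAlgebraic ℚ_[p] φ := by
    obtain ⟨P, hP, hP0⟩ := hfin.to_isIntegral ⟨φ, hφ⟩
    refine IsIntegral.isAlgebraic ⟨P.map PadicInt.Coe.ringHom, hP.map _, ?_⟩
    rw [eval₂_map]
    have := congrArg W.subtype hP0
    rw [hom_eval₂, map_zero] at this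
    exact this
  rcases W.mem_or_inv_mem RatFunc.X with h | h
  · exact RatFunc.transcendental_X (halg _ h)
  · exact RatFunc.transcendental_X (IsAlgebraic.inv_iff.1 (halg _ h))

/-- Let `W` be a residually algebraic torsion extension of `ℤ_p` to
`ℚ_p(X)`, with ramification index `e = e(W|ℤ_p)` and residue degree `f = f(W|ℤ_p)`.  Then
`e · f = ∞`: it is impossible that both the value group of `W` has finite index over the
value group of `ℤ_p` (i.e. some fixed power of every nonzero `φ` has the value of a constant)
and the residue field of `W` is a finite extension of `𝔽_p` (i.e. finite). -/
theorem stmt_5 (p : ℕ) [Fact p.Prime]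
    (W : ValuationSubring (RatFunc ℚ_[p])) (hW : IsResAlgTorsionQp p W) :
    ¬ ((∃ N : ℕ, 0 < N ∧ ∀ φ : RatFunc ℚ_[p], φ ≠ 0 → ∃ c : ℚ_[p], c ≠ 0 ∧
          φ ^ N / RatFunc.C c ∈ W ∧ RatFunc.C c / φ ^ N ∈ W) ∧
        Finite (IsLocalRing.ResidueField W)) := by
  rintro ⟨⟨N, hN, h⟩, _⟩
  have hC := hW.1
  let : Algebra ℤ_[p] W := (padicIntToSubring W hC).toAlgebra
  have hp : (p : W) ∈ IsLocalRing.maximalIdeal W := by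
    rw [IsLocalRing.mem_maximalIdeal, mem_nonunits_iff, isUnit_iff_dvd_one]
    rintro ⟨y, hy⟩
    have hy' : (1 : RatFunc ℚ_[p]) = p * y := by
      simpa using congrArg (Subtype.val : W → RatFunc ℚ_[p]) hy
    have hle := (hC (p : ℚ_[p])⁻¹).1 (by
      rw [map_inv₀, map_natCast, inv_eq_of_mul_eq_one_right hy'.symm]; exact y.2)
    rw [norm_inv, Padic.norm_p, inv_inv] at hle
    exact absurd (Fact.out : p.Prime).one_lt (not_lt.2 (by exact_mod_cast hle))
  have hquot : Finite (W ⧸ Ideal.span {(p : W)}) :=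
    ValuationRing.finite_quotient_span_singleton hp
      (ValuationRing.maximalIdeal_pow_le_span_singleton hN.ne' fun x hx =>
        RatFunc.natCast_dvd_pow_of_mem_maximalIdeal hC hN h hx)
  have : IsPrecomplete (Ideal.span {(p : ℤ_[p])}) ℤ_[p] := by
    rw [← PadicInt.maximalIdeal_eq_span_p]; infer_instance
  have : IsHausdorff (Ideal.span {(p : ℤ_[p])}) W := by
    refine ⟨fun x hx => ?_⟩
    by_contra hx0
    obtain ⟨c, hc, -, h2⟩ := h x (by simpa using hx0)
    refine hx0 (RatFunc.eq_zero_of_forall_pow_dvd hC hN hc h2 fun n => ?_)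
    obtain ⟨z, hz⟩ := (smodEq_pow_span_singleton_iff _ n _ _).1 (hx n)
    exact ⟨z, by simpa [Algebra.smul_def] using hz.symm⟩
  have : Finite (W ⧸ (Ideal.span {(p : ℤ_[p])} • ⊤ : Submodule ℤ_[p] W)) := by
    have heq : (Ideal.span {(p : ℤ_[p])} • ⊤ : Submodule ℤ_[p] W) =
        (Ideal.span {(p : W)}).restrictScalars ℤ_[p] := by
      rw [Ideal.smul_top_eq_map, Ideal.map_span]
      simp
    rw [heq]
    exact hquot
  exact padicIntToSubring_not_finite W hC
    (Module.Finite.of_isHausdorff_of_finite_quotient (p : ℤ_[p]) : Module.Finite ℤ_[p] W)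

end
end
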